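/- Let A and B be groups and let φ : A →* MulAut B be a group homomorphism, with semidirect product B ⋊[φ] A. Then the abelianization of B ⋊[φ] A is isomorphic (as a group) to the product (Abelianization A) × ((Abelianization B) ⧸ H), where H is the subgroup of Abelianization B generated by all elements of the form (Abelianization.of (φ a b)) * (Abelianization.of b)⁻¹ with a ∈ A and b ∈ B. -/

import Mathlib

namespace SemidirectProduct

variable {A B : Type*} [Group A] [Group B] (φ : A →* MulAut B)

/-- The subgroup of `Abelianization B` whose quotient is the group of coinvariants of the action
of `A` on `Abelianization B`. -/
def coinvariantsSubgroup : Subgroup (Abelianization B) :=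
  Subgroup.closure {x : Abelianization B | ∃ (a : A) (b : B),
    x = Abelianization.of (φ a b) * (Abelianization.of b)⁻¹}

/-- The projection of a semidirect product onto the coinvariants of the abelianized normal
factor. -/
def toCoinvariants : B ⋊[φ] A →* Abelianization B ⧸ coinvariantsSubgroup φ :=
  lift ((QuotientGroup.mk' _).comp Abelianization.of) 1 fun a ↦ by
    ext b
    suffices h : (QuotientGroup.mk' (coinvariantsSubgroup φ)) (Abelianization.of (φ a b)) =
        QuotientGroup.mk' (coinvariantsSubgroup φ) (Abelianization.of b) by simpa using h
    rw [← div_eq_one, ← map_div, ← MonoidHom.mem_ker, QuotientGroup.ker_mk', div_eq_mul_inv]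
    exact Subgroup.subset_closure ⟨a, b, rfl⟩

theorem coinvariantsSubgroup_le_ker_map_inl :
    coinvariantsSubgroup φ ≤ (Abelianization.map (inl : B →* B ⋊[φ] A)).ker := by
  rw [coinvariantsSubgroup, Subgroup.closure_le]
  rintro _ ⟨a, b, rfl⟩
  simp [MonoidHom.mem_ker, inl_aut]

/-- The abelianization of a semidirect product is the product of the abelianization of the acting
group and the coinvariants of the abelianized normal factor. -/
def abelianizationEquiv :
    Abelianization (B ⋊[φ] A) ≃*
      Abelianization A × (Abelianization B ⧸ coinvariantsSubgroup φ) :=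
  MonoidHom.toMulEquiv
    (Abelianization.lift ((Abelianization.of.comp rightHom).prod (toCoinvariants φ)))
    ((Abelianization.map inr).coprod
      (QuotientGroup.lift _ (Abelianization.map inl) (coinvariantsSubgroup_le_ker_map_inl φ)))
    (by
      apply Abelianization.hom_ext
      apply hom_ext <;> ext x <;> simp [toCoinvariants])
    (by
      apply MonoidHom.ext
      rintro ⟨x, y⟩
      obtain ⟨a, rfl : Abelianization.of a = x⟩ := QuotientGroup.mk'_surjective _ x
      obtain ⟨y, rfl⟩ := QuotientGroup.mk'_surjective _ y
      obtain ⟨b, rfl : Abelianization.of b = y⟩ := QuotientGroup.mk'_surjective _ y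
      simp [toCoinvariants])

end SemidirectProduct


/-- The abelianization of a semidirect product `B ⋊[φ] A` is isomorphic to
`(Abelianization A) × ((Abelianization B) ⧸ H)`, where `H` is the subgroup of
`Abelianization B` generated by the elements `Abelianization.of (φ a b) * (Abelianization.of b)⁻¹`. -/
theorem abelianization_semidirectProduct
    {A B : Type*} [Group A] [Group B] (φ : A →* MulAut B)
    (H : Subgroup (Abelianization B))
    (hH : H = Subgroup.closure
      {x : Abelianization B | ∃ (a : A) (b : B),
        x = Abelianization.of (φ a b) * (Abelianization.of b)⁻¹}) :
    Nonempty (Abelianization (B ⋊[φ] A) ≃* Abelianization A × (Abelianization B ⧸ H)) := by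
  subst hH
  exact ⟨SemidirectProduct.abelianizationEquiv φ⟩
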